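/- Let κ satisfy the energy, consistency, and domination principles (neither (A1) nor (A2) is assumed). Let A ⊂ X be a Borel set, let (U_j)_{j≥1} be an increasing sequence of Borel subsets of X with ⋃_j U_j = X, and set A_j := A ∩ U_j. Then for every μ ∈ E⁺ the sequence of inner balayages (μ^{A_j}) converges to μ^A both strongly (‖μ^{A_j} − μ^A‖ → 0) and vaguely. -/

import Mathlib

open MeasureTheory Filter Topology Set
open scoped ENNReal NNReal

namespace Balayage

variable {X : Type*} [TopologicalSpace X] [T2Space X] [LocallyCompactSpace X]
  [MeasurableSpace X] [BorelSpace X]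

/-- The potential `κμ(x) := ∫ κ(x,y) dμ(y)`. -/
noncomputable def pot (κ : X → X → ℝ≥0∞) (μ : Measure X) (x : X) : ℝ≥0∞ :=
  ∫⁻ y, κ x y ∂μ

/-- The mutual energy `κ(μ,ν) := ∬ κ(x,y) d(μ⊗ν)(x,y)`. -/
noncomputable def energy (κ : X → X → ℝ≥0∞) (μ ν : Measure X) : ℝ≥0∞ :=
  ∫⁻ x, pot κ ν x ∂μ

/-- A positive Radon measure: locally finite and inner regular. -/
def IsRadon (μ : Measure X) : Prop :=
  μ.InnerRegular ∧ IsLocallyFiniteMeasure μ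

/-- `E⁺`: the positive Radon measures of finite energy. -/
def Eplus (κ : X → X → ℝ≥0∞) : Set (Measure X) :=
  {μ | IsRadon μ ∧ energy κ μ μ < ⊤}

/-- `μ` is concentrated on `A`: `A` is `μ`-measurable and `X∖A` is locally `μ`-negligible. -/
def ConcOn (μ : Measure X) (A : Set X) : Prop :=
  NullMeasurableSet A μ ∧ ∀ K : Set X, IsCompact K → μ (Aᶜ ∩ K) = 0

/-- `E⁺_A`: measures of finite energy concentrated on `A`. -/
def EplusOn (κ : X → X → ℝ≥0∞) (A : Set X) : Set (Measure X) :=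
  {μ ∈ Eplus κ | ConcOn μ A}

/-- The inner capacity `c_*(A)`. -/
noncomputable def innerCap (κ : X → X → ℝ≥0∞) (A : Set X) : ℝ≥0∞ :=
  (⨅ μ ∈ {μ ∈ EplusOn κ A | μ Set.univ = 1}, energy κ μ μ)⁻¹

/-- `P` holds nearly everywhere on `A`: the set where it fails has inner capacity zero. -/
def NEOn (κ : X → X → ℝ≥0∞) (A : Set X) (P : X → Prop) : Prop :=
  innerCap κ {x | x ∈ A ∧ ¬ P x} = 0

/-- The outer capacity `c^*(A)`. -/
noncomputable def outerCap (κ : X → X → ℝ≥0∞) (A : Set X) : ℝ≥0∞ :=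
  ⨅ D ∈ {D : Set X | IsOpen D ∧ A ⊆ D}, innerCap κ D

/-- `P` holds quasi-everywhere on `A`: the set where it fails has outer capacity zero. -/
def QEOn (κ : X → X → ℝ≥0∞) (A : Set X) (P : X → Prop) : Prop :=
  outerCap κ {x | x ∈ A ∧ ¬ P x} = 0

/-- The class `Λ_{A,μ}` of measures `ν ∈ E⁺` with `κν ≥ κμ` n.e. on `A`. -/
def InnerLam (κ : X → X → ℝ≥0∞) (A : Set X) (μ : Measure X) : Set (Measure X) :=
  {ν ∈ Eplus κ | NEOn κ A (fun x => pot κ μ x ≤ pot κ ν x)}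

/-- The class `Λ*_{A,μ}` of measures `ν ∈ E⁺` with `κν ≥ κμ` q.e. on `A`. -/
def OuterLam (κ : X → X → ℝ≥0∞) (A : Set X) (μ : Measure X) : Set (Measure X) :=
  {ν ∈ Eplus κ | QEOn κ A (fun x => pot κ μ x ≤ pot κ ν x)}

/-- `b` is the inner balayage `μ^A`: the measure of minimal potential in `Λ_{A,μ}`. -/
def IsInnerBal (κ : X → X → ℝ≥0∞) (A : Set X) (μ b : Measure X) : Prop :=
  b ∈ InnerLam κ A μ ∧ ∀ ν ∈ InnerLam κ A μ, ∀ x, pot κ b x ≤ pot κ ν x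

/-- `b` is the outer balayage `μ^{*A}`: the measure of minimal potential in `Λ*_{A,μ}`. -/
def IsOuterBal (κ : X → X → ℝ≥0∞) (A : Set X) (μ b : Measure X) : Prop :=
  b ∈ OuterLam κ A μ ∧ ∀ ν ∈ OuterLam κ A μ, ∀ x, pot κ b x ≤ pot κ ν x

/-- The strong (energy) distance `‖μ − ν‖`. -/
noncomputable def strDist (κ : X → X → ℝ≥0∞) (μ ν : Measure X) : ℝ :=
  Real.sqrt ((energy κ μ μ).toReal - 2 * (energy κ μ ν).toReal + (energy κ ν ν).toReal)

/-- The energy principle (strict positive definiteness). -/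
def EnergyPrinciple (κ : X → X → ℝ≥0∞) : Prop :=
  ∀ μ ∈ Eplus κ, ∀ ν ∈ Eplus κ,
    2 * energy κ μ ν ≤ energy κ μ μ + energy κ ν ν ∧
      (2 * energy κ μ ν = energy κ μ μ + energy κ ν ν → μ = ν)

/-- Vague convergence of a net of measures along a filter. -/
def VagueConv {ι : Type*} (F : Filter ι) (m : ι → Measure X) (ν : Measure X) : Prop :=
  ∀ f : X → ℝ, Continuous f → HasCompactSupport f →
    Tendsto (fun i => ∫ x, f x ∂(m i)) F (nhds (∫ x, f x ∂ν))

/-- A net of measures is strong Cauchy (for the energy metric) along a filter. -/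
def StrongCauchy (κ : X → X → ℝ≥0∞) {ι : Type*} (F : Filter ι) (m : ι → Measure X) : Prop :=
  ∀ ε : ℝ, 0 < ε → ∃ s ∈ F, ∀ i ∈ s, ∀ j ∈ s, strDist κ (m i) (m j) < ε

/-- The consistency principle: every strong Cauchy net in `E⁺` converges strongly
to each of its vague limit points. -/
def Consistent (κ : X → X → ℝ≥0∞) : Prop :=
  ∀ (ι : Type) (F : Filter ι) (m : ι → Measure X), F.NeBot →
    (∀ i, m i ∈ Eplus κ) → StrongCauchy κ F m →
    ∀ ν : Measure X, (∃ G : Filter ι, G ≤ F ∧ G.NeBot ∧ VagueConv G m ν) →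
      Tendsto (fun i => strDist κ (m i) ν) F (nhds 0)

/-- The domination principle. -/
def Domination (κ : X → X → ℝ≥0∞) : Prop :=
  ∀ μ ∈ Eplus κ, ∀ ν ∈ Eplus κ,
    (∀ᵐ x ∂μ, pot κ μ x ≤ pot κ ν x) → ∀ x, pot κ μ x ≤ pot κ ν x

/-- A kernel: symmetric and lower semicontinuous. -/
structure IsKernel (κ : X → X → ℝ≥0∞) : Prop where
  symm : ∀ x y, κ x y = κ y x
  lsc : LowerSemicontinuous (Function.uncurry κ)

/-- `E'_A`: the strong closure of `E⁺_A` within `E⁺`. -/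
def EclosOn (κ : X → X → ℝ≥0∞) (A : Set X) : Set (Measure X) :=
  {ν ∈ Eplus κ | ∀ ε : ℝ, 0 < ε → ∃ μ ∈ EplusOn κ A, strDist κ ν μ < ε}

/-- The (real-valued) potential of the signed measure `λ = lp − lm`. -/
noncomputable def spot (κ : X → X → ℝ≥0∞) (lp lm : Measure X) (x : X) : ℝ :=
  (pot κ lp x).toReal - (pot κ lm x).toReal

/-- Assumption (A2): every `f ∈ C_c(X)` is the limit, uniformly with supports in one fixed
compact set, of a sequence of potentials of signed measures of finite energy that are
continuous and compactly supported. -/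
def A2 (κ : X → X → ℝ≥0∞) : Prop :=
  ∀ f : X → ℝ, Continuous f → HasCompactSupport f →
    ∃ (K : Set X) (lp lm : ℕ → Measure X), IsCompact K ∧ tsupport f ⊆ K ∧
      (∀ j, lp j ∈ Eplus κ ∧ lm j ∈ Eplus κ) ∧
      (∀ j x, pot κ (lp j) x ≠ ⊤ ∨ pot κ (lm j) x ≠ ⊤) ∧
      (∀ j, Continuous (spot κ (lp j) (lm j))) ∧
      (∀ j, tsupport (spot κ (lp j) (lm j)) ⊆ K) ∧
      TendstoUniformly (fun j => spot κ (lp j) (lm j)) f atTop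

set_option linter.unusedSectionVars false

section TauAdditivity

variable {Y : Type*} [TopologicalSpace Y] [MeasurableSpace Y]

theorem measure_le_iSup_inter_of_directed {μ : Measure Y} (hμ : μ.InnerRegular) {ι : Type*}
    [Nonempty ι] {O : ι → Set Y} (hO : ∀ i, IsOpen (O i)) (hd : Directed (· ⊆ ·) O) {S : Set Y}
    (hS : MeasurableSet S) (hSO : S ⊆ ⋃ i, O i) : μ S ≤ ⨆ i, μ (S ∩ O i) := by
  rw [hS.measure_eq_iSup_isCompact]
  refine iSup_le fun K => iSup_le fun hKS => iSup_le fun hK => ?_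
  obtain ⟨i, hi⟩ := hK.elim_directed_cover O hO (hKS.trans hSO) hd
  exact le_iSup_of_le i (measure_mono (subset_inter hKS hi))

/-- Inner regular measures are `τ`-additive: they commute with directed suprema of lower
semicontinuous functions. -/
theorem lintegral_iSup_of_lsc_of_directed [BorelSpace Y] {μ : Measure Y} (hμ : μ.InnerRegular) {ι : Type*}
    [Nonempty ι] {f : ι → Y → ℝ≥0∞} (hf : ∀ i, LowerSemicontinuous (f i))
    (hd : Directed (· ≤ ·) f) :
    ∫⁻ y, ⨆ i, f i y ∂μ = ⨆ i, ∫⁻ y, f i y ∂μ := by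
  refine le_antisymm ?_ (iSup_lintegral_le _)
  rw [lintegral_eq_nnreal]
  refine iSup_le fun s => iSup_le fun hsf => ?_
  refine ENNReal.le_of_forall_lt_one_mul_le fun a ha => ?_
  rcases ENNReal.lt_iff_exists_coe.1 ha with ⟨r, rfl, _⟩
  have ha : r < 1 := ENNReal.coe_lt_coe.1 ha
  set t : SimpleFunc Y ℝ≥0∞ := s.map (↑) with ht
  have hdir : ∀ c : ℝ≥0∞, Directed (· ⊆ ·) fun i => {y | c < f i y} := fun c i j =>
    (hd i j).imp fun k hk => ⟨fun y hy => lt_of_lt_of_le hy (hk.1 y),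
      fun y hy => lt_of_lt_of_le hy (hk.2 y)⟩
  have hpiece : ∀ c ∈ t.range, r * (c * μ (t ⁻¹' {c})) ≤
      ⨆ i, r * (c * μ (t ⁻¹' {c} ∩ {y | r * c < f i y})) := by
    intro c _
    rcases eq_or_ne c 0 with rfl | hc
    · simp
    rw [← ENNReal.mul_iSup, ← ENNReal.mul_iSup]
    gcongr
    refine measure_le_iSup_inter_of_directed hμ (fun i => (hf i).isOpen_preimage _) (hdir _)
      (SimpleFunc.measurableSet_preimage _ _) fun y hy => ?_
    have hy' : (s y : ℝ≥0∞) = c := by simpa [ht] using hy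
    have hlt : (r : ℝ≥0∞) * c < ⨆ i, f i y := by
      refine lt_of_lt_of_le ?_ (hsf y)
      rw [← hy'] at hc ⊢
      have h0 : s y ≠ 0 := by exact_mod_cast hc
      have : r * s y < 1 * s y := by gcongr
      rw [one_mul] at this
      exact_mod_cast this
    obtain ⟨i, hi⟩ := lt_iSup_iff.1 hlt
    exact mem_iUnion.2 ⟨i, hi⟩
  calc (r : ℝ≥0∞) * t.lintegral μ = ∑ c ∈ t.range, r * (c * μ (t ⁻¹' {c})) := by
        rw [SimpleFunc.lintegral, Finset.mul_sum]
    _ ≤ ∑ c ∈ t.range, ⨆ i, r * (c * μ (t ⁻¹' {c} ∩ {y | r * c < f i y})) :=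
        Finset.sum_le_sum hpiece
    _ = ⨆ i, ∑ c ∈ t.range, r * (c * μ (t ⁻¹' {c} ∩ {y | r * c < f i y})) := by
        refine ENNReal.finsetSum_iSup fun i j => (hd i j).imp fun k hk c => ⟨?_, ?_⟩
        · gcongr; exact hk.1 _
        · gcongr; exact hk.2 _
    _ ≤ ⨆ i, ∫⁻ y, f i y ∂μ := by
        refine iSup_mono fun i => ?_
        have hm : MeasurableSet {y | r * t y < f i y} :=
          measurableSet_lt (measurable_const.mul t.measurable) (hf i).measurable
        calc ∑ c ∈ t.range, r * (c * μ (t ⁻¹' {c} ∩ {y | r * c < f i y}))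
            = r * t.lintegral (μ.restrict {y | r * t y < f i y}) := by
              rw [SimpleFunc.lintegral_restrict, Finset.mul_sum]
              refine Finset.sum_congr rfl fun c _ => ?_
              congr 3
              ext y
              simp only [mem_inter_iff, mem_preimage, mem_singleton_iff, mem_ofPred_eq]
              constructor <;> rintro ⟨rfl, h⟩ <;> exact ⟨rfl, h⟩
          _ = ∫⁻ y in {y | r * t y < f i y}, r * t y ∂μ := by
              rw [lintegral_const_mul _ t.measurable, SimpleFunc.lintegral_eq_lintegral]
          _ ≤ ∫⁻ y in {y | r * t y < f i y}, f i y ∂μ :=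
              setLIntegral_mono_ae (hf i).measurable.aemeasurable
                (ae_of_all _ fun y hy => le_of_lt hy)
          _ ≤ ∫⁻ y, f i y ∂μ := setLIntegral_le_lintegral _ _

end TauAdditivity

section Minorants

variable {Y : Type*} [TopologicalSpace Y]

/-- The nonnegative continuous functions with compact support lying below `g`. -/
def ccMinorants (g : Y → ℝ≥0∞) : Set C(Y, ℝ) :=
  {F | HasCompactSupport F ∧ (∀ y, 0 ≤ F y) ∧ ∀ y, ENNReal.ofReal (F y) ≤ g y}

theorem zero_mem_ccMinorants (g : Y → ℝ≥0∞) : (0 : C(Y, ℝ)) ∈ ccMinorants g :=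
  ⟨HasCompactSupport.zero, fun _ => le_rfl, fun _ => by simp⟩

instance (g : Y → ℝ≥0∞) : Nonempty (ccMinorants g) := ⟨⟨0, zero_mem_ccMinorants g⟩⟩

theorem sup_mem_ccMinorants {g : Y → ℝ≥0∞} {F G : C(Y, ℝ)} (hF : F ∈ ccMinorants g)
    (hG : G ∈ ccMinorants g) : F ⊔ G ∈ ccMinorants g := by
  refine ⟨?_, fun y => le_sup_of_le_left (hF.2.1 y), fun y => ?_⟩
  · refine HasCompactSupport.intro' (IsCompact.union hF.1 hG.1)
      ((isClosed_tsupport _).union (isClosed_tsupport _)) fun y hy => ?_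
    rw [mem_union, not_or] at hy
    simp [image_eq_zero_of_notMem_tsupport hy.1, image_eq_zero_of_notMem_tsupport hy.2]
  · rcases le_total (F y) (G y) with h | h
    · simpa [h] using hG.2.2 y
    · simpa [h] using hF.2.2 y

theorem directed_ccMinorants (g : Y → ℝ≥0∞) :
    Directed (· ≤ ·) fun (F : ccMinorants g) (y : Y) => ENNReal.ofReal (F.1 y) := fun F G =>
  ⟨⟨F.1 ⊔ G.1, sup_mem_ccMinorants F.2 G.2⟩,
    fun _ => ENNReal.ofReal_le_ofReal le_sup_left,
    fun _ => ENNReal.ofReal_le_ofReal le_sup_right⟩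

theorem iSup_ccMinorants [T2Space Y] [LocallyCompactSpace Y] {g : Y → ℝ≥0∞}
    (hg : LowerSemicontinuous g) (y : Y) :
    ⨆ F : ccMinorants g, ENNReal.ofReal (F.1 y) = g y := by
  refine le_antisymm (iSup_le fun F => F.2.2.2 y) (le_of_forall_lt fun c hc => ?_)
  obtain ⟨d, hcd, hdg⟩ := exists_between hc
  lift d to ℝ≥0 using (hdg.trans_le le_top).ne
  obtain ⟨f, hf1, hf0, hfc, hf⟩ := exists_continuous_one_zero_of_isCompact
    (isCompact_singleton (x := y)) (hg.isOpen_preimage (d : ℝ≥0∞)).isClosed_compl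
    (disjoint_compl_right_iff_subset.2 (by simpa using hdg))
  refine lt_of_lt_of_le hcd ?_
  refine le_iSup_of_le (⟨(d : ℝ) • f, ?_, fun z => ?_, fun z => ?_⟩ : ccMinorants g) ?_
  · exact hfc.mono' (by
      rw [ContinuousMap.coe_smul]
      exact (Function.support_const_smul_subset _ _).trans (subset_tsupport _))
  · exact mul_nonneg d.2 (hf z).1
  · by_cases hz : (d : ℝ≥0∞) < g z
    · refine le_trans (ENNReal.ofReal_le_of_le_toReal ?_) hz.le
      simpa using mul_le_mul_of_nonneg_left (hf z).2 d.2
    · have := hf0 (show z ∈ (g ⁻¹' Ioi (d : ℝ≥0∞))ᶜ from hz)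
      simp [this]
  · have := hf1 (mem_singleton y)
    simp [this]

end Minorants

section Potentials

variable {κ : X → X → ℝ≥0∞}

theorem hasCompactSupport_section {F : C(X × X, ℝ)} (hF : HasCompactSupport F) (x : X) :
    HasCompactSupport fun y => F (x, y) :=
  HasCompactSupport.intro (hF.image continuous_snd) fun y hy => by
    by_contra h
    exact hy ⟨(x, y), subset_tsupport _ h, rfl⟩

theorem continuous_integral_section {F : C(X × X, ℝ)} (hF : HasCompactSupport F)
    {ν : Measure X} (hν : IsRadon ν) : Continuous fun x => ∫ y, F (x, y) ∂ν := by
  have := hν.2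
  rw [← continuousOn_univ]
  refine continuousOn_integral_of_compact_support (hF.image continuous_snd)
    (f := fun x y => F (x, y)) F.continuous.continuousOn fun x y _ hy => ?_
  by_contra h
  exact hy ⟨(x, y), subset_tsupport _ h, rfl⟩

theorem hasCompactSupport_integral_section {F : C(X × X, ℝ)} (hF : HasCompactSupport F)
    (ν : Measure X) : HasCompactSupport fun x => ∫ y, F (x, y) ∂ν :=
  HasCompactSupport.intro (hF.image continuous_fst) fun x hx => by
    have : ∀ y, F (x, y) = 0 := fun y => by
      by_contra h
      exact hx ⟨(x, y), subset_tsupport _ h, rfl⟩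
    simp [this]

theorem integrable_section {F : C(X × X, ℝ)} (hF : HasCompactSupport F) {ν : Measure X}
    (hν : IsRadon ν) (x : X) : Integrable (fun y => F (x, y)) ν := by
  have := hν.2
  exact Continuous.integrable_of_hasCompactSupport (by fun_prop) (hasCompactSupport_section hF x)

theorem lintegral_section {F : C(X × X, ℝ)} (hF : HasCompactSupport F) (h0 : ∀ p, 0 ≤ F p)
    {ν : Measure X} (hν : IsRadon ν) (x : X) :
    ∫⁻ y, ENNReal.ofReal (F (x, y)) ∂ν = ENNReal.ofReal (∫ y, F (x, y) ∂ν) :=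
  (ofReal_integral_eq_lintegral_ofReal (integrable_section hF hν x)
    (ae_of_all _ fun _ => h0 _)).symm

theorem pot_eq_iSup (hker : IsKernel κ) {ν : Measure X} (hν : IsRadon ν) (x : X) :
    pot κ ν x = ⨆ F : ccMinorants (Function.uncurry κ), ENNReal.ofReal (∫ y, F.1 (x, y) ∂ν) := by
  have h : ∀ y, κ x y = ⨆ F : ccMinorants (Function.uncurry κ), ENNReal.ofReal (F.1 (x, y)) :=
    fun y => (iSup_ccMinorants hker.lsc (x, y)).symm
  simp_rw [pot, h]
  rw [lintegral_iSup_of_lsc_of_directed hν.1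
    (f := fun F : ccMinorants (Function.uncurry κ) => fun y => ENNReal.ofReal (F.1 (x, y)))
    (fun F => (ENNReal.continuous_ofReal.comp
      (F.1.continuous.comp (Continuous.prodMk_right x))).lowerSemicontinuous)
    fun F G => (directed_ccMinorants _ F G).imp fun H hH =>
      ⟨fun y => hH.1 (x, y), fun y => hH.2 (x, y)⟩]
  exact iSup_congr fun F => lintegral_section F.2.1 F.2.2.1 hν x

theorem lowerSemicontinuous_pot (hker : IsKernel κ) {ν : Measure X} (hν : IsRadon ν) :
    LowerSemicontinuous (pot κ ν) := by
  have : pot κ ν = fun x => ⨆ F : ccMinorants (Function.uncurry κ),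
      ENNReal.ofReal (∫ y, F.1 (x, y) ∂ν) := funext fun x => pot_eq_iSup hker hν x
  rw [this]
  exact lowerSemicontinuous_iSup fun F => (ENNReal.continuous_ofReal.comp
    (continuous_integral_section F.2.1 hν)).lowerSemicontinuous

theorem measurable_pot (hker : IsKernel κ) {ν : Measure X} (hν : IsRadon ν) :
    Measurable (pot κ ν) := (lowerSemicontinuous_pot hker hν).measurable

theorem energy_eq_iSup (hker : IsKernel κ) {μ ν : Measure X} (hμ : IsRadon μ) (hν : IsRadon ν) :
    energy κ μ ν = ⨆ F : ccMinorants (Function.uncurry κ),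
      ENNReal.ofReal (∫ x, ∫ y, F.1 (x, y) ∂ν ∂μ) := by
  have := hμ.2
  simp_rw [energy, pot_eq_iSup hker hν]
  rw [lintegral_iSup_of_lsc_of_directed hμ.1
    (f := fun F : ccMinorants (Function.uncurry κ) => fun x =>
      ENNReal.ofReal (∫ y, F.1 (x, y) ∂ν))
    (fun F => (ENNReal.continuous_ofReal.comp
      (continuous_integral_section F.2.1 hν)).lowerSemicontinuous)]
  · refine iSup_congr fun F => (ofReal_integral_eq_lintegral_ofReal
      ((continuous_integral_section F.2.1 hν).integrable_of_hasCompactSupport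
        (hasCompactSupport_integral_section F.2.1 ν))
      (ae_of_all _ fun _ => integral_nonneg fun _ => F.2.2.1 _)).symm
  · intro F G
    obtain ⟨H, hFH, hGH⟩ := directed_ccMinorants _ F G
    refine ⟨H, fun x => ?_, fun x => ?_⟩
    · simp only [← lintegral_section F.2.1 F.2.2.1 hν, ← lintegral_section H.2.1 H.2.2.1 hν]
      exact lintegral_mono fun y => hFH (x, y)
    · simp only [← lintegral_section G.2.1 G.2.2.1 hν, ← lintegral_section H.2.1 H.2.2.1 hν]
      exact lintegral_mono fun y => hGH (x, y)

/-- The pullback of a minorant of `κ` under the swap of coordinates is again a minorant. -/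
theorem swap_mem_ccMinorants (hker : IsKernel κ) {F : C(X × X, ℝ)}
    (hF : F ∈ ccMinorants (Function.uncurry κ)) :
    F.comp ⟨Prod.swap, continuous_swap⟩ ∈ ccMinorants (Function.uncurry κ) :=
  ⟨hF.1.comp_homeomorph (Homeomorph.prodComm X X), fun _ => hF.2.1 _, fun p => by
    have := hF.2.2 p.swap
    rwa [Function.uncurry, Prod.fst_swap, Prod.snd_swap, hker.symm] at this⟩

theorem energy_comm (hker : IsKernel κ) {μ ν : Measure X} (hμ : IsRadon μ) (hν : IsRadon ν) :
    energy κ μ ν = energy κ ν μ := by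
  have key : ∀ {μ ν : Measure X}, IsRadon μ → IsRadon ν → energy κ μ ν ≤ energy κ ν μ := by
    intro μ ν hμ hν
    rw [energy_eq_iSup hker hμ hν, energy_eq_iSup hker hν hμ]
    refine iSup_le fun F => le_iSup_of_le ⟨_, swap_mem_ccMinorants hker F.2⟩ (le_of_eq ?_)
    have := hμ.2
    have := hν.2
    congr 1
    exact integral_integral_swap_of_hasCompactSupport (f := fun x y => F.1 (x, y))
      F.1.continuous F.2.1
  exact le_antisymm (key hμ hν) (key hν hμ)

end Potentials

section VagueCompactness

/-- The inner regularization of a measure: `s ↦ sup {μ (s ∩ K) : K compact}`. -/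
noncomputable def innerPart (μ : Measure X) : Measure X :=
  Measure.ofMeasurable (fun s _ => ⨆ K : TopologicalSpace.Compacts X, μ (s ∩ K)) (by simp) (by
    intro s hs hd
    have h : ∀ K : TopologicalSpace.Compacts X, μ ((⋃ i, s i) ∩ K) = ∑' i, μ (s i ∩ K) := by
      intro K
      rw [iUnion_inter]
      exact measure_iUnion (fun i j hij => (hd hij).mono inter_subset_left inter_subset_left)
        fun i => (hs i).inter K.isCompact.measurableSet
    simp_rw [h, ENNReal.tsum_eq_iSup_sum]
    rw [iSup_comm]
    refine iSup_congr fun t => (ENNReal.finsetSum_iSup fun K L => ⟨K ⊔ L, fun i => ?_⟩).symm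
    constructor <;> gcongr <;> simp)

theorem innerPart_apply (μ : Measure X) {s : Set X} (hs : MeasurableSet s) :
    innerPart μ s = ⨆ K : TopologicalSpace.Compacts X, μ (s ∩ K) :=
  Measure.ofMeasurable_apply s hs

theorem innerPart_le (μ : Measure X) : innerPart μ ≤ μ :=
  Measure.le_iff.2 fun s hs => by
    rw [innerPart_apply μ hs]
    exact iSup_le fun K => measure_mono inter_subset_left

theorem innerPart_restrict_of_isCompact (μ : Measure X) {K : Set X} (hK : IsCompact K) :
    (innerPart μ).restrict K = μ.restrict K := by
  ext s hs
  rw [Measure.restrict_apply hs, Measure.restrict_apply hs,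
    innerPart_apply μ (hs.inter hK.measurableSet)]
  refine le_antisymm (iSup_le fun L => measure_mono inter_subset_left)
    (le_iSup_of_le ⟨K, hK⟩ (measure_mono fun x hx => ⟨hx, hx.2⟩))

theorem innerPart_apply_of_isCompact (μ : Measure X) {K : Set X} (hK : IsCompact K) :
    innerPart μ K = μ K := by
  have := congrArg (fun m : Measure X => m univ) (innerPart_restrict_of_isCompact μ hK)
  simpa using this

theorem isRadon_innerPart (μ : Measure X) [μ.Regular] : IsRadon (innerPart μ) := by
  refine ⟨⟨fun s hs r hr => ?_⟩, ⟨fun x => ?_⟩⟩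
  · rw [innerPart_apply μ hs] at hr
    obtain ⟨L, hL⟩ := lt_iSup_iff.1 hr
    obtain ⟨K, hKs, hK, hrK⟩ := (hs.inter L.isCompact.measurableSet).exists_lt_isCompact_of_ne_top
      ((measure_mono inter_subset_right).trans_lt L.isCompact.measure_lt_top).ne hL
    exact ⟨K, hKs.trans inter_subset_left, hK, by rwa [innerPart_apply_of_isCompact μ hK]⟩
  · obtain ⟨s, hs, hfin⟩ := μ.finiteAt_nhds x
    exact ⟨s, hs, (innerPart_le μ s).trans_lt hfin⟩

theorem integral_innerPart (μ : Measure X) {f : X → ℝ} (hf : HasCompactSupport f) :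
    ∫ x, f x ∂(innerPart μ) = ∫ x, f x ∂μ := by
  have h : ∀ x, x ∉ tsupport f → f x = 0 := fun x hx => image_eq_zero_of_notMem_tsupport hx
  rw [← setIntegral_eq_integral_of_forall_compl_eq_zero (μ := innerPart μ) h,
    ← setIntegral_eq_integral_of_forall_compl_eq_zero (μ := μ) h, innerPart_restrict_of_isCompact μ hf]

open scoped CompactlySupported in
/-- Vague relative compactness: a net of Radon measures that is bounded on compact sets has a
vague limit along any ultrafilter. -/
theorem exists_isRadon_vagueConv {ι : Type*} (G : Ultrafilter ι) {m : ι → Measure X}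
    (hm : ∀ i, IsRadon (m i))
    (hb : ∀ K, IsCompact K → ∃ C : ℝ≥0, ∀ i, m i K ≤ C) :
    ∃ ν, IsRadon ν ∧ VagueConv (G : Filter ι) m ν := by
  have hint : ∀ i (f : C_c(X, ℝ)), Integrable f (m i) := fun i f => by
    have := (hm i).2
    exact f.continuous.integrable_of_hasCompactSupport f.hasCompactSupport
  have hlim : ∀ f : C_c(X, ℝ), ∃ a : ℝ, Tendsto (fun i => ∫ x, f x ∂(m i)) G (𝓝 a) := by
    intro f
    obtain ⟨C, hC⟩ := hb _ f.hasCompactSupport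
    obtain ⟨M, hM0, hM⟩ : ∃ M : ℝ, 0 ≤ M ∧ ∀ x, ‖f x‖ ≤ M := by
      obtain ⟨M, hM⟩ := f.continuous.bounded_above_of_compact_support f.hasCompactSupport
      exact ⟨max M 0, le_max_right _ _, fun x => (hM x).trans (le_max_left _ _)⟩
    have hbd : ∀ i, ∫ x, f x ∂(m i) ∈ Metric.closedBall (0 : ℝ) (M * C) := by
      intro i
      have hfin : m i (tsupport f) < ⊤ := (hC i).trans_lt ENNReal.coe_lt_top
      rw [mem_closedBall_zero_iff, ← setIntegral_eq_integral_of_forall_compl_eq_zero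
        (s := tsupport f) fun x hx => image_eq_zero_of_notMem_tsupport hx]
      refine (norm_setIntegral_le_of_norm_le_const hfin fun x _ => hM x).trans ?_
      exact mul_le_mul_of_nonneg_left (ENNReal.toReal_le_coe_of_le_coe (hC i)) hM0
    obtain ⟨a, -, ha⟩ := (isCompact_closedBall (0 : ℝ) (M * C)).ultrafilter_le_nhds
      (G.map fun i => ∫ x, f x ∂(m i))
      (le_principal_iff.2 (mem_map.2 (univ_mem' hbd)))
    exact ⟨a, ha⟩
  choose L hL using hlim
  let Λ : C_c(X, ℝ) →ₚ[ℝ] ℝ := PositiveLinearMap.mk₀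
    { toFun := L
      map_add' := fun f g => tendsto_nhds_unique (hL (f + g)) (by
        simpa [integral_add (hint _ f) (hint _ g)] using (hL f).add (hL g))
      map_smul' := fun c f => tendsto_nhds_unique (hL (c • f)) (by
        simpa [integral_const_mul] using (hL f).const_mul c) }
    (fun f hf => ge_of_tendsto' (hL f) fun i => integral_nonneg hf)
  refine ⟨innerPart (RealRMK.rieszMeasure Λ), isRadon_innerPart _, fun f hfc hfs => ?_⟩
  rw [integral_innerPart _ hfs]
  have h := RealRMK.integral_rieszMeasure Λ ⟨⟨f, hfc⟩, hfs⟩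
  have h' := hL ⟨⟨f, hfc⟩, hfs⟩
  rw [show L ⟨⟨f, hfc⟩, hfs⟩ = Λ ⟨⟨f, hfc⟩, hfs⟩ from rfl, ← h] at h'
  exact h'

end VagueCompactness

section FiniteEnergy

variable {κ : X → X → ℝ≥0∞}

theorem IsRadon.restrict {μ : Measure X} (h : IsRadon μ) {s : Set X} (hs : MeasurableSet s) :
    IsRadon (μ.restrict s) := by
  have := h.2
  refine ⟨⟨fun t ht r hr => ?_⟩, inferInstance⟩
  rw [Measure.restrict_apply ht] at hr
  obtain ⟨K, hKs, hK, hrK⟩ := h.1.innerRegular (ht.inter hs) r hr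
  refine ⟨K, hKs.trans inter_subset_left, hK, ?_⟩
  rwa [Measure.restrict_apply hK.measurableSet,
    inter_eq_left.2 (hKs.trans inter_subset_right)]

theorem IsRadon.smul {μ : Measure X} (h : IsRadon μ) {c : ℝ≥0∞} (hc : c ≠ ⊤) :
    IsRadon (c • μ) := by
  have := h.1
  refine ⟨inferInstance, ⟨fun x => ?_⟩⟩
  obtain ⟨s, hs, hfin⟩ := h.2.finiteAtNhds x
  exact ⟨s, hs, ENNReal.mul_lt_top hc.lt_top hfin⟩

theorem IsRadon.add {μ ν : Measure X} (hμ : IsRadon μ) (hν : IsRadon ν) : IsRadon (μ + ν) := by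
  have := hμ.1
  have := hν.1
  refine ⟨inferInstance, ⟨fun x => ?_⟩⟩
  obtain ⟨s, hs, hfin⟩ := hμ.2.finiteAtNhds x
  obtain ⟨t, ht, hfin'⟩ := hν.2.finiteAtNhds x
  exact ⟨s ∩ t, inter_mem hs ht, ENNReal.add_lt_top.2
    ⟨(measure_mono inter_subset_left).trans_lt hfin,
      (measure_mono inter_subset_right).trans_lt hfin'⟩⟩

theorem isRadon_dirac (x : X) : IsRadon (Measure.dirac x) := by
  refine ⟨⟨fun s hs r hr => ?_⟩, inferInstance⟩
  have hx : x ∈ s := by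
    by_contra h
    simp [Measure.dirac_apply' x hs, h] at hr
  exact ⟨{x}, by simpa using hx, isCompact_singleton, hr.trans_le (prob_le_one.trans (by simp))⟩

theorem energy_mono_left {μ μ' : Measure X} (h : μ ≤ μ') (ν : Measure X) :
    energy κ μ ν ≤ energy κ μ' ν := lintegral_mono' h le_rfl

theorem energy_mono_right (μ : Measure X) {ν ν' : Measure X}
    (h : ∀ x, pot κ ν x ≤ pot κ ν' x) : energy κ μ ν ≤ energy κ μ ν' := lintegral_mono h

theorem pot_mono {ν ν' : Measure X} (h : ν ≤ ν') (x : X) : pot κ ν x ≤ pot κ ν' x :=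
  lintegral_mono' h le_rfl

theorem energy_add_left (μ μ' ν : Measure X) :
    energy κ (μ + μ') ν = energy κ μ ν + energy κ μ' ν := lintegral_add_measure _ _ _

theorem energy_smul_left (c : ℝ≥0∞) (μ ν : Measure X) :
    energy κ (c • μ) ν = c * energy κ μ ν := lintegral_smul_measure _ _

theorem energy_smul_right {c : ℝ≥0∞} (hc : c ≠ ⊤) (μ ν : Measure X) :
    energy κ μ (c • ν) = c * energy κ μ ν := by
  simp only [energy, pot, lintegral_smul_measure, smul_eq_mul]
  exact lintegral_const_mul' _ _ hc

theorem restrict_mem_Eplus {μ : Measure X} (h : μ ∈ Eplus κ) {s : Set X} (hs : MeasurableSet s) :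
    μ.restrict s ∈ Eplus κ :=
  ⟨h.1.restrict hs, ((energy_mono_left Measure.restrict_le_self _).trans
    (energy_mono_right _ (pot_mono Measure.restrict_le_self))).trans_lt h.2⟩

theorem smul_mem_Eplus {μ : Measure X} (h : μ ∈ Eplus κ) {c : ℝ≥0∞} (hc : c ≠ ⊤) :
    c • μ ∈ Eplus κ := by
  refine ⟨h.1.smul hc, ?_⟩
  rw [energy_smul_left, energy_smul_right hc]
  exact ENNReal.mul_lt_top hc.lt_top (ENNReal.mul_lt_top hc.lt_top h.2)

theorem energy_lt_top (hE : EnergyPrinciple κ) {μ ν : Measure X} (hμ : μ ∈ Eplus κ)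
    (hν : ν ∈ Eplus κ) : energy κ μ ν < ⊤ := by
  have h := (hE μ hμ ν hν).1.trans_lt (ENNReal.add_lt_top.2 ⟨hμ.2, hν.2⟩)
  refine lt_of_le_of_lt ?_ h
  rw [two_mul]
  exact le_self_add

/-- The square of the strong distance, which the energy principle makes nonnegative. -/
theorem strDist_sq (hE : EnergyPrinciple κ) {μ ν : Measure X} (hμ : μ ∈ Eplus κ)
    (hν : ν ∈ Eplus κ) : strDist κ μ ν ^ 2 =
      (energy κ μ μ).toReal - 2 * (energy κ μ ν).toReal + (energy κ ν ν).toReal := by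
  refine Real.sq_sqrt ?_
  have h := ENNReal.toReal_mono (ENNReal.add_lt_top.2 ⟨hμ.2, hν.2⟩).ne (hE μ hμ ν hν).1
  rw [ENNReal.toReal_mul, ENNReal.toReal_add hμ.2.ne hν.2.ne, ENNReal.toReal_ofNat] at h
  linarith

theorem strDist_comm (hker : IsKernel κ) {μ ν : Measure X} (hμ : IsRadon μ) (hν : IsRadon ν) :
    strDist κ μ ν = strDist κ ν μ := by
  rw [strDist, strDist, energy_comm hker hμ hν]
  congr 1
  ring

theorem energy_perturbation (hker : IsKernel κ) (hE : EnergyPrinciple κ) {a b σ : Measure X}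
    (ha : a ∈ Eplus κ) (hb : b ∈ Eplus κ) (hσ : σ ∈ Eplus κ) {t : ℝ} (ht : 0 ≤ t) :
    2 * t * ((energy κ σ b).toReal - (energy κ σ a).toReal) ≤
      strDist κ b a ^ 2 + t ^ 2 * (energy κ σ σ).toReal := by
  lift t to ℝ≥0 using ht
  have hc : IsRadon (a + (t : ℝ≥0∞) • σ) := ha.1.add (hσ.1.smul ENNReal.coe_ne_top)
  have haa := ha.2
  have hbb := hb.2
  have hss := hσ.2
  have hsa := energy_lt_top hE hσ ha
  have hsb := energy_lt_top hE hσ hb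
  have hab := energy_lt_top hE ha hb
  have hcc : energy κ (a + (t : ℝ≥0∞) • σ) (a + (t : ℝ≥0∞) • σ) =
      energy κ a a + t * energy κ σ a + t * (energy κ σ a + t * energy κ σ σ) := by
    rw [energy_add_left, energy_smul_left, energy_comm hker ha.1 hc, energy_comm hker hσ.1 hc]
    simp only [energy_add_left, energy_smul_left, energy_comm hker ha.1 hσ.1]
  have hcb : energy κ (a + (t : ℝ≥0∞) • σ) b = energy κ a b + t * energy κ σ b := by
    rw [energy_add_left, energy_smul_left]
  have h := (hE _ ⟨hc, by rw [hcc]; finiteness⟩ b hb).1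
  rw [hcc, hcb] at h
  have h' := ENNReal.toReal_mono (by finiteness) h
  rw [strDist_comm hker hb.1 ha.1, strDist_sq hE ha hb]
  lift energy κ a a to ℝ≥0 using haa.ne with eaa
  lift energy κ b b to ℝ≥0 using hbb.ne with ebb
  lift energy κ σ σ to ℝ≥0 using hss.ne with ess
  lift energy κ σ a to ℝ≥0 using hsa.ne with esa
  lift energy κ σ b to ℝ≥0 using hsb.ne with esb
  lift energy κ a b to ℝ≥0 using hab.ne with eab
  norm_cast at h
  have h2 : (2 : ℝ) * (eab + t * esb) ≤ eaa + t * esa + t * (esa + t * ess) + ebb := by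
    exact_mod_cast h
  simp only [ENNReal.coe_toReal]
  nlinarith

/-- Strong convergence implies upper semicontinuity of the mutual energy with a fixed measure. -/
theorem le_energy_of_tendsto_strDist (hker : IsKernel κ) (hE : EnergyPrinciple κ)
    {ι : Type*} {l : Filter ι} [l.NeBot] {m : ι → Measure X} {ν σ : Measure X}
    (hm : ∀ i, m i ∈ Eplus κ) (hν : ν ∈ Eplus κ) (hσ : σ ∈ Eplus κ)
    (hlim : Tendsto (fun i => strDist κ (m i) ν) l (𝓝 0)) {c : ℝ}
    (hc : ∀ᶠ i in l, c ≤ (energy κ σ (m i)).toReal) : c ≤ (energy κ σ ν).toReal := by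
  by_contra! hlt
  set d := c - (energy κ σ ν).toReal with hd
  set S := (energy κ σ σ).toReal with hS
  have hS0 : 0 ≤ S := ENNReal.toReal_nonneg
  have hd0 : 0 < d := sub_pos.2 hlt
  set t := d / (S + 1) with ht
  have ht0 : 0 < t := by positivity
  have hle : 2 * t * d ≤ 0 ^ 2 + t ^ 2 * S := by
    refine ge_of_tendsto ((hlim.pow 2).add_const (t ^ 2 * S)) ?_
    filter_upwards [hc] with i hi
    refine le_trans ?_ (energy_perturbation hker hE hν (hm i) hσ ht0.le)
    gcongr
    exact sub_le_sub_right hi _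
  have htS : t * (S + 1) = d := by rw [ht]; field_simp
  nlinarith [mul_pos ht0 hd0, mul_pos ht0 ht0]

theorem kernel_diag_pos (hE : EnergyPrinciple κ) (hker : IsKernel κ) (x : X) : 0 < κ x x := by
  rw [pos_iff_ne_zero]
  intro h0
  have hz : energy κ (Measure.dirac x) (Measure.dirac x) = 0 := by
    rw [energy, lintegral_dirac' x (measurable_pot hker (isRadon_dirac x)), pot, lintegral_dirac'
      x (f := κ x) (hker.lsc.comp (Continuous.prodMk_right x)).measurable, h0]
  have hzero : (0 : Measure X) ∈ Eplus κ :=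
    ⟨⟨inferInstance, inferInstance⟩, by simp [energy]⟩
  have h := (hE _ ⟨isRadon_dirac x, by simp [hz]⟩ 0 hzero).2 (by rw [hz]; simp [energy, pot])
  exact Measure.dirac_ne_zero h

/-- Measures of uniformly bounded energy are uniformly bounded on compact sets. -/
theorem exists_measure_le_of_energy_le (hker : IsKernel κ) (hE : EnergyPrinciple κ)
    {ι : Type*} {m : ι → Measure X} {C : ℝ≥0∞} (hC : C ≠ ⊤) (hm : ∀ i, energy κ (m i) (m i) ≤ C)
    {K : Set X} (hK : IsCompact K) : ∃ B : ℝ≥0, ∀ i, m i K ≤ B := by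
  refine hK.induction_on (p := fun s => ∃ B : ℝ≥0, ∀ i, m i s ≤ B) ⟨0, by simp⟩
    (fun s t hst ⟨B, hB⟩ => ⟨B, fun i => (measure_mono hst).trans (hB i)⟩)
    (fun s t ⟨B, hB⟩ ⟨B', hB'⟩ => ⟨B + B', fun i => (measure_union_le s t).trans
      (by push_cast; exact add_le_add (hB i) (hB' i))⟩) fun x _ => ?_
  obtain ⟨c, hc0, hcx⟩ := exists_between (kernel_diag_pos hE hker x)
  have hopen : IsOpen (Function.uncurry κ ⁻¹' Ioi c) := hker.lsc.isOpen_preimage c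
  obtain ⟨V, W, hV, hxV, hW, hxW, hVW⟩ := mem_nhds_prod_iff'.1 (hopen.mem_nhds
    (show (x, x) ∈ Function.uncurry κ ⁻¹' Ioi c from hcx))
  set O := V ∩ W with hO
  have hOm : MeasurableSet O := (hV.inter hW).measurableSet
  refine ⟨O, mem_nhdsWithin_of_mem_nhds ((hV.inter hW).mem_nhds ⟨hxV, hxW⟩),
    (max 1 (C / c)).toNNReal, fun i => ?_⟩
  rw [ENNReal.coe_toNNReal (max_lt ENNReal.one_lt_top (ENNReal.div_lt_top hC hc0.ne')).ne]
  rcases le_total (m i O) 1 with h1 | h1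
  · exact h1.trans (le_max_left _ _)
  refine le_trans ?_ (le_max_right _ _)
  rw [ENNReal.le_div_iff_mul_le (Or.inl hc0.ne') (Or.inl (hcx.trans_le le_top).ne)]
  calc m i O * c ≤ c * m i O * m i O := by
        rw [mul_comm]; exact le_mul_of_one_le_right' h1
    _ = ∫⁻ _ in O, ∫⁻ _ in O, c ∂(m i) ∂(m i) := by simp
    _ ≤ ∫⁻ x in O, ∫⁻ y in O, κ x y ∂(m i) ∂(m i) :=
        setLIntegral_mono' hOm fun y hy => setLIntegral_mono' hOm fun z hz =>
          le_of_lt (hVW (show (y, z) ∈ V ×ˢ W from ⟨hy.1, hz.2⟩))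
    _ ≤ energy κ (m i) (m i) := lintegral_mono' Measure.restrict_le_self
        fun _ => lintegral_mono' Measure.restrict_le_self le_rfl
    _ ≤ C := hm i

end FiniteEnergy

section Capacity

variable {κ : X → X → ℝ≥0∞}

/-- A Borel set has zero inner capacity iff it is null for every measure of finite energy. -/
theorem innerCap_eq_zero_iff {E : Set X} (hEm : MeasurableSet E) :
    innerCap κ E = 0 ↔ ∀ τ ∈ Eplus κ, τ E = 0 := by
  rw [innerCap, ENNReal.inv_eq_zero]
  constructor
  · intro h τ hτ
    by_contra hne
    obtain ⟨K, hKE, hK, hK0⟩ := hτ.1.1.innerRegular hEm 0 (pos_iff_ne_zero.2 hne)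
    have := hτ.1.2
    have hKtop : τ K ≠ ⊤ := hK.measure_lt_top.ne
    have hc : (τ K)⁻¹ ≠ ⊤ := ENNReal.inv_ne_top.2 hK0.ne'
    have hσ := smul_mem_Eplus (restrict_mem_Eplus hτ hK.measurableSet) hc
    have hconc : ConcOn ((τ K)⁻¹ • τ.restrict K) E := by
      refine ⟨hEm.nullMeasurableSet, fun L hL => ?_⟩
      have hdisj : (Eᶜ ∩ L) ∩ K = ∅ := by
        ext x
        simp only [mem_inter_iff, mem_compl_iff, mem_empty_iff_false, iff_false]
        exact fun hx => hx.1.1 (hKE hx.2)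
      rw [Measure.smul_apply, Measure.restrict_apply (hEm.compl.inter hL.measurableSet), hdisj]
      simp
    have huniv : ((τ K)⁻¹ • τ.restrict K) univ = 1 := by
      simpa using ENNReal.inv_mul_cancel hK0.ne' hKtop
    have hmem : (τ K)⁻¹ • τ.restrict K ∈ {μ ∈ EplusOn κ E | μ Set.univ = 1} :=
      ⟨⟨hσ, hconc⟩, huniv⟩
    have hinf : (⨅ μ ∈ {μ ∈ EplusOn κ E | μ Set.univ = 1}, energy κ μ μ) ≤
        energy κ ((τ K)⁻¹ • τ.restrict K) ((τ K)⁻¹ • τ.restrict K) := iInf₂_le _ hmem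
    rw [h] at hinf
    exact hσ.2.not_ge hinf
  · intro h
    refine iInf₂_eq_top.2 fun τ hτ => ?_
    exfalso
    have hcompl : τ Eᶜ = 0 := by
      by_contra hne
      obtain ⟨K, hKE, hK, hK0⟩ := hτ.1.1.1.1.innerRegular hEm.compl 0 (pos_iff_ne_zero.2 hne)
      have := hτ.1.2.2 K hK
      rw [inter_eq_right.2 hKE] at this
      exact hK0.ne' this
    have h1 : τ univ ≤ τ E + τ Eᶜ := by
      rw [← union_compl_self E]; exact measure_union_le _ _
    rw [h τ hτ.1.1, hcompl, hτ.2] at h1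
    simp at h1

theorem measurableSet_pot_lt (hker : IsKernel κ) {A : Set X} (hA : MeasurableSet A)
    {μ ν : Measure X} (hμ : IsRadon μ) (hν : IsRadon ν) :
    MeasurableSet {x | x ∈ A ∧ ¬ pot κ μ x ≤ pot κ ν x} :=
  hA.inter (measurableSet_le (measurable_pot hker hμ) (measurable_pot hker hν)).compl

theorem mem_innerLam_iff (hker : IsKernel κ) {A : Set X} (hA : MeasurableSet A)
    {μ ν : Measure X} (hμ : μ ∈ Eplus κ) : ν ∈ InnerLam κ A μ ↔
      ν ∈ Eplus κ ∧ ∀ τ ∈ Eplus κ, τ {x | x ∈ A ∧ ¬ pot κ μ x ≤ pot κ ν x} = 0 :=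
  and_congr_right fun hν => innerCap_eq_zero_iff (measurableSet_pot_lt hker hA hμ.1 hν.1)

theorem innerLam_anti (hker : IsKernel κ) {A B : Set X} (hA : MeasurableSet A)
    (hB : MeasurableSet B) (hAB : A ⊆ B) {μ : Measure X} (hμ : μ ∈ Eplus κ) :
    InnerLam κ B μ ⊆ InnerLam κ A μ := fun ν hν => by
  rw [mem_innerLam_iff hker hB hμ] at hν
  exact (mem_innerLam_iff hker hA hμ).2
    ⟨hν.1, fun τ hτ => measure_mono_null (by
      rintro x ⟨hxA, hx⟩
      exact ⟨hAB hxA, hx⟩) (hν.2 τ hτ)⟩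

end Capacity

section Convergence

variable {κ : X → X → ℝ≥0∞}

theorem energy_self_le_of_pot_le (hker : IsKernel κ) {μ ν : Measure X} (hμ : IsRadon μ)
    (hν : IsRadon ν) (h : ∀ x, pot κ μ x ≤ pot κ ν x) : energy κ μ μ ≤ energy κ ν ν :=
  (energy_mono_right μ h).trans
    ((energy_comm hker hμ hν).trans_le (energy_mono_right ν h))

theorem eq_of_pot_eq (hker : IsKernel κ) (hE : EnergyPrinciple κ) {μ ν : Measure X}
    (hμ : μ ∈ Eplus κ) (hν : ν ∈ Eplus κ) (h : pot κ μ = pot κ ν) : μ = ν := by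
  refine (hE μ hμ ν hν).2 ?_
  have h1 : energy κ μ μ = energy κ μ ν := by simp only [energy, h]
  have h2 : energy κ ν ν = energy κ μ ν := by
    rw [energy_comm hker hμ.1 hν.1]; simp only [energy, h]
  rw [h1, h2, two_mul]

theorem strongCauchy_of_pot_mono (hker : IsKernel κ) (hE : EnergyPrinciple κ)
    {b : ℕ → Measure X} (hb : ∀ j, b j ∈ Eplus κ)
    (hmono : ∀ {i j}, i ≤ j → ∀ x, pot κ (b i) x ≤ pot κ (b j) x) {C : ℝ≥0∞} (hC : C ≠ ⊤)
    (hbd : ∀ j, energy κ (b j) (b j) ≤ C) : StrongCauchy κ atTop b := by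
  set e : ℕ → ℝ := fun j => (energy κ (b j) (b j)).toReal with he
  have hemono : Monotone e := fun i j hij => ENNReal.toReal_mono (hb j).2.ne
    (energy_self_le_of_pot_le hker (hb i).1 (hb j).1 (hmono hij))
  have hecauchy : CauchySeq e := (tendsto_atTop_ciSup hemono ⟨C.toReal, by
    rintro _ ⟨j, rfl⟩
    exact ENNReal.toReal_mono hC (hbd j)⟩).cauchySeq
  have hdist : ∀ {i j}, i ≤ j → strDist κ (b i) (b j) ^ 2 ≤ |e i - e j| := by
    intro i j hij
    rw [strDist_sq hE (hb i) (hb j)]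
    have h : e i ≤ (energy κ (b i) (b j)).toReal := ENNReal.toReal_mono
      (energy_lt_top hE (hb i) (hb j)).ne (energy_mono_right _ (hmono hij))
    have := neg_le_abs (e i - e j)
    simp only [he] at *
    linarith
  have hdist' : ∀ i j, strDist κ (b i) (b j) ^ 2 ≤ |e i - e j| := by
    intro i j
    rcases le_total i j with hij | hij
    · exact hdist hij
    · rw [strDist_comm hker (hb i).1 (hb j).1, abs_sub_comm]
      exact hdist hij
  intro ε hε
  obtain ⟨N, hN⟩ := Metric.cauchySeq_iff.1 hecauchy (ε ^ 2) (by positivity)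
  exact ⟨Ici N, Ici_mem_atTop N, fun i hi j hj =>
    lt_of_pow_lt_pow_left₀ 2 hε.le ((hdist' i j).trans_lt (hN i hi j hj))⟩

/-- Principle of descent: potentials are lower semicontinuous along vague convergence. -/
theorem pot_le_of_vagueConv (hker : IsKernel κ) {ι : Type*} {l : Filter ι} [l.NeBot]
    {m : ι → Measure X} {ν : Measure X} (hm : ∀ i, IsRadon (m i)) (hν : IsRadon ν)
    (hlim : VagueConv l m ν) {g : X → ℝ≥0∞} (hg : ∀ i x, pot κ (m i) x ≤ g x) (x : X) :
    pot κ ν x ≤ g x := by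
  rw [pot_eq_iSup hker hν]
  refine iSup_le fun F => ?_
  refine le_of_tendsto' ((ENNReal.continuous_ofReal.tendsto _).comp
    (hlim _ (by fun_prop) (hasCompactSupport_section F.2.1 x))) fun i => ?_
  refine le_trans ?_ (hg i x)
  rw [pot_eq_iSup hker (hm i)]
  exact le_iSup (fun F : ccMinorants (Function.uncurry κ) =>
    ENNReal.ofReal (∫ y, F.1 (x, y) ∂(m i))) F

theorem mem_innerLam_of_tendsto_strDist (hker : IsKernel κ) (hE : EnergyPrinciple κ)
    {A : Set X} (hA : MeasurableSet A) {U : ℕ → Set X} (hU : ∀ j, MeasurableSet (U j))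
    (hUmono : Monotone U) (hUuniv : ⋃ j, U j = univ) {μ ν : Measure X} {b : ℕ → Measure X}
    (hμ : μ ∈ Eplus κ) (hb : ∀ j, b j ∈ Eplus κ) (hν : ν ∈ Eplus κ)
    (hbΛ : ∀ j, b j ∈ InnerLam κ (A ∩ U j) μ)
    (hlim : Tendsto (fun j => strDist κ (b j) ν) atTop (𝓝 0)) : ν ∈ InnerLam κ A μ := by
  refine (mem_innerLam_iff hker hA hμ).2 ⟨hν, fun τ hτ => ?_⟩
  set N := {x | x ∈ A ∧ ¬ pot κ μ x ≤ pot κ ν x} with hN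
  have hNm : MeasurableSet N := measurableSet_pot_lt hker hA hμ.1 hν.1
  have hcover : N = ⋃ i, N ∩ U i := by rw [← inter_iUnion, hUuniv, inter_univ]
  rw [hcover]
  refine measure_iUnion_null fun i => ?_
  have hSm : MeasurableSet (N ∩ U i) := hNm.inter (hU i)
  set σ := τ.restrict (N ∩ U i) with hσ
  have hσE : σ ∈ Eplus κ := restrict_mem_Eplus hτ hSm
  have hσmem : ∀ᵐ x ∂σ, x ∈ N ∩ U i := ae_restrict_mem hSm
  have hev : ∀ᶠ j in atTop, (energy κ σ μ).toReal ≤ (energy κ σ (b j)).toReal := by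
    filter_upwards [eventually_ge_atTop i] with j hij
    refine ENNReal.toReal_mono (energy_lt_top hE hσE (hb j)).ne (lintegral_mono_ae ?_)
    have hnull := ((mem_innerLam_iff hker (hA.inter (hU j)) hμ).1 (hbΛ j)).2 σ hσE
    filter_upwards [hσmem, measure_eq_zero_iff_ae_notMem.1 hnull] with x hx hx'
    by_contra hlt
    exact hx' ⟨⟨hx.1.1, hUmono hij hx.2⟩, hlt⟩
  have hle : energy κ σ μ ≤ energy κ σ ν :=
    (ENNReal.toReal_le_toReal (energy_lt_top hE hσE hμ).ne (energy_lt_top hE hσE hν).ne).1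
      (le_energy_of_tendsto_strDist hker hE hb hν hσE hlim hev)
  have hae : pot κ ν =ᵐ[σ] pot κ μ := ae_eq_of_ae_le_of_lintegral_le
    (hσmem.mono fun x hx => (not_le.1 hx.1.2).le) (energy_lt_top hE hσE hν).ne
    (measurable_pot hker hμ.1).aemeasurable hle
  have hfalse : ∀ᵐ x ∂σ, False := by
    filter_upwards [hσmem, hae] with x hx hx'
    exact hx.1.2 hx'.ge
  have hσ0 : σ = 0 := ae_eq_bot.1 (eventually_false_iff_eq_bot.1 hfalse)
  exact Measure.restrict_eq_zero.1 hσ0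

end Convergence

/-- For Borel `A`, inner balayages along the exhaustion `A_j = A ∩ U_j` converge to
`μ^A` strongly and vaguely, without assuming (A1) or (A2). -/
theorem statement17 (κ : X → X → ℝ≥0∞) (hker : IsKernel κ)
    (hE : EnergyPrinciple κ) (hC : Consistent κ) (hD : Domination κ)
    (A : Set X) (hAmeas : MeasurableSet A) (U : ℕ → Set X)
    (hUmeas : ∀ j, MeasurableSet (U j)) (hUmono : Monotone U)
    (hUuniv : (⋃ j, U j) = Set.univ) :
    ∀ μ ∈ Eplus κ, ∀ bA : Measure X, IsInnerBal κ A μ bA →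
      ∀ bj : ℕ → Measure X, (∀ j, IsInnerBal κ (A ∩ U j) μ (bj j)) →
        Tendsto (fun j => strDist κ (bj j) bA) atTop (nhds (0 : ℝ)) ∧
        VagueConv atTop bj bA := by
  intro μ hμ bA hbA bj hbj
  have hAU : ∀ j, MeasurableSet (A ∩ U j) := fun j => hAmeas.inter (hUmeas j)
  have hbAE : bA ∈ Eplus κ := hbA.1.1
  have hbE : ∀ j, bj j ∈ Eplus κ := fun j => (hbj j).1.1
  have hle : ∀ j x, pot κ (bj j) x ≤ pot κ bA x := fun j =>
    (hbj j).2 bA (innerLam_anti hker (hAU j) hAmeas inter_subset_left hμ hbA.1)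
  have hmono : ∀ {i j}, i ≤ j → ∀ x, pot κ (bj i) x ≤ pot κ (bj j) x := fun {i j} hij =>
    (hbj i).2 (bj j) (innerLam_anti hker (hAU i) (hAU j)
      (inter_subset_inter_right _ (hUmono hij)) hμ (hbj j).1)
  have henergy : ∀ j, energy κ (bj j) (bj j) ≤ energy κ bA bA :=
    fun j => energy_self_le_of_pot_le hker (hbE j).1 hbAE.1 (hle j)
  have hcauchy : StrongCauchy κ atTop bj :=
    strongCauchy_of_pot_mono hker hE hbE hmono hbAE.2.ne henergy
  have hlimit : ∀ G : Ultrafilter ℕ, (G : Filter ℕ) ≤ atTop → VagueConv (G : Filter ℕ) bj bA ∧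
      Tendsto (fun j => strDist κ (bj j) bA) atTop (𝓝 0) := by
    intro G hG
    obtain ⟨ν, hν, hGν⟩ := exists_isRadon_vagueConv G (fun j => (hbE j).1)
      fun K hK => exists_measure_le_of_energy_le hker hE hbAE.2.ne henergy hK
    have hνle : ∀ x, pot κ ν x ≤ pot κ bA x :=
      pot_le_of_vagueConv hker (fun j => (hbE j).1) hν hGν hle
    have hνE : ν ∈ Eplus κ := ⟨hν, (energy_self_le_of_pot_le hker hν hbAE.1 hνle).trans_lt hbAE.2⟩
    have hstrong := hC ℕ atTop bj inferInstance hbE hcauchy ν ⟨G, hG, inferInstance, hGν⟩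
    have hνΛ := mem_innerLam_of_tendsto_strDist hker hE hAmeas hUmeas hUmono hUuniv hμ hbE
      hνE (fun j => (hbj j).1) hstrong
    obtain rfl := eq_of_pot_eq hker hE hνE hbAE
      (funext fun x => le_antisymm (hνle x) (hbA.2 ν hνΛ x))
    exact ⟨hGν, hstrong⟩
  exact ⟨(hlimit (hyperfilter ℕ) Nat.hyperfilter_le_atTop).2, fun f hf hfs =>
    (tendsto_iff_ultrafilter _ _ _).2 fun G hG => (hlimit G hG).1 f hf hfs⟩

end Balayage
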